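/- Let h : ℝⁿ → ℝ be a smooth function and q a nonnegative integer such that all partial derivatives ∂^β h(0) vanish for every multi-index β with |β| < q. Let γ be a multi-index and set θ := max(|γ|, q). Then for every x ∈ ℝⁿ, λ^{−θ} ∂^γ(h ∘ f_λ)(x) = λ^{|γ| − θ} (∂^γ h)(λx) converges, as λ → 0⁺, to Σ_{|β| = θ − |γ|} (∂^{β+γ} h)(0) x^β / β!, i.e. to the homogeneous Taylor polynomial of degree θ − |γ| of ∂^γ h at 0 evaluated at x; in particular, when |γ| ≥ q the limit is (∂^γ h)(0). -/

import Mathlib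

open Filter Topology

/-- The partial derivative `∂_i` of a function on `ℝⁿ`. -/
noncomputable def pder {n : ℕ} {E : Type*} [NormedAddCommGroup E] [NormedSpace ℝ E]
    (i : Fin n) (f : (Fin n → ℝ) → E) : (Fin n → ℝ) → E :=
  fun x => fderiv ℝ f x (Pi.single i 1)

/-- The iterated partial derivative `∂^γ = ∂₀^{γ₀} ∘ ⋯ ∘ ∂_{n−1}^{γ_{n−1}}` attached to a
multi-index `γ`. -/
noncomputable def mpder {n : ℕ} {E : Type*} [NormedAddCommGroup E] [NormedSpace ℝ E]
    (γ : Fin n → ℕ) : ((Fin n → ℝ) → E) → ((Fin n → ℝ) → E) :=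
  (List.ofFn fun i : Fin n => (pder i)^[γ i]).foldr (· ∘ ·) id

section Derivatives

variable {n : ℕ} {E : Type*} [NormedAddCommGroup E] [NormedSpace ℝ E]

theorem ContDiff.pder {f : (Fin n → ℝ) → E} (hf : ContDiff ℝ (⊤ : ℕ∞) f) (i : Fin n) :
    ContDiff ℝ (⊤ : ℕ∞) (pder i f) :=
  (hf.fderiv_right (m := (⊤ : ℕ∞)) (by norm_cast)).clm_apply contDiff_const

theorem ContDiff.pder_iterate {f : (Fin n → ℝ) → E} (hf : ContDiff ℝ (⊤ : ℕ∞) f) (i : Fin n)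
    (k : ℕ) : ContDiff ℝ (⊤ : ℕ∞) ((_root_.pder i)^[k] f) := by
  induction k with
  | zero => exact hf
  | succ k ih => rw [Function.iterate_succ_apply']; exact ih.pder i

theorem pder_comm {f : (Fin n → ℝ) → E} (hf : ContDiff ℝ (⊤ : ℕ∞) f) (i j : Fin n) :
    pder i (pder j f) = pder j (pder i f) := by
  have hd : Differentiable ℝ (fderiv ℝ f) :=
    (hf.fderiv_right (m := (⊤ : ℕ∞)) (by norm_cast)).differentiable (by simp)
  have key : ∀ (i j : Fin n) (x : Fin n → ℝ),
      pder i (pder j f) x = fderiv ℝ (fderiv ℝ f) x (Pi.single i 1) (Pi.single j 1) := by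
    intro i j x
    have := ((hd x).hasFDerivAt.clm_apply (hasFDerivAt_const (Pi.single j (1 : ℝ)) x)).fderiv
    change fderiv ℝ (fun y => fderiv ℝ f y (Pi.single j 1)) x (Pi.single i 1) = _
    rw [this]
    simp
  funext x
  rw [key, key]
  have h2 : (2 : WithTop ℕ∞) ≤ ((⊤ : ℕ∞) : WithTop ℕ∞) := WithTop.coe_le_coe.2 le_top
  exact (hf.contDiffAt.isSymmSndFDerivAt (by simpa using h2)).eq _ _

theorem pder_pder_iterate {f : (Fin n → ℝ) → E} (hf : ContDiff ℝ (⊤ : ℕ∞) f) (i j : Fin n)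
    (k : ℕ) : pder i ((pder j)^[k] f) = (pder j)^[k] (pder i f) := by
  induction k with
  | zero => rfl
  | succ k ih =>
    rw [Function.iterate_succ_apply', Function.iterate_succ_apply', ← ih,
      pder_comm (hf.pder_iterate j k)]

/-- The composition of the iterated partial derivatives `∂_i^{γ_i}` over `i` in a list. -/
noncomputable def listPder (γ : Fin n → ℕ) (L : List (Fin n)) :
    ((Fin n → ℝ) → E) → ((Fin n → ℝ) → E) :=
  (L.map fun i => (pder i)^[γ i]).foldr (· ∘ ·) id

theorem mpder_eq_listPder (γ : Fin n → ℕ) :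
    mpder (E := E) γ = listPder γ (List.finRange n) := by
  rw [mpder, listPder, List.ofFn_eq_map]

theorem listPder_cons (γ : Fin n → ℕ) (a : Fin n) (L : List (Fin n)) (f : (Fin n → ℝ) → E) :
    listPder γ (a :: L) f = (pder a)^[γ a] (listPder γ L f) := rfl

theorem ContDiff.listPder {f : (Fin n → ℝ) → E} (hf : ContDiff ℝ (⊤ : ℕ∞) f) (γ : Fin n → ℕ)
    (L : List (Fin n)) : ContDiff ℝ (⊤ : ℕ∞) (listPder γ L f) := by
  induction L with
  | nil => exact hf
  | cons a L ih => exact ih.pder_iterate a (γ a)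

theorem pder_listPder {f : (Fin n → ℝ) → E} (hf : ContDiff ℝ (⊤ : ℕ∞) f) (i : Fin n)
    (γ : Fin n → ℕ) (L : List (Fin n)) :
    pder i (listPder γ L f) = listPder γ L (pder i f) := by
  induction L with
  | nil => rfl
  | cons a L ih =>
    rw [listPder_cons, listPder_cons, ← ih, pder_pder_iterate (hf.listPder γ L)]

theorem pder_iterate_listPder {f : (Fin n → ℝ) → E} (hf : ContDiff ℝ (⊤ : ℕ∞) f) (i : Fin n)
    (k : ℕ) (γ : Fin n → ℕ) (L : List (Fin n)) :
    (pder i)^[k] (listPder γ L f) = listPder γ L ((pder i)^[k] f) := by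
  induction k with
  | zero => rfl
  | succ k ih =>
    rw [Function.iterate_succ_apply', Function.iterate_succ_apply', ih,
      pder_listPder (hf.pder_iterate i k)]

theorem listPder_add {f : (Fin n → ℝ) → E} (hf : ContDiff ℝ (⊤ : ℕ∞) f) (β γ : Fin n → ℕ)
    (L : List (Fin n)) : listPder (β + γ) L f = listPder β L (listPder γ L f) := by
  induction L with
  | nil => rfl
  | cons a L ih =>
    rw [listPder_cons, listPder_cons, listPder_cons, ih, Pi.add_apply, Function.iterate_add_apply,
      pder_iterate_listPder (hf.listPder γ L)]

theorem listPder_single_of_notMem {i : Fin n} {L : List (Fin n)} (hi : i ∉ L)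
    (f : (Fin n → ℝ) → E) : listPder (Pi.single i 1) L f = f := by
  induction L with
  | nil => rfl
  | cons a L ih =>
    rw [List.mem_cons, not_or] at hi
    rw [listPder_cons, ih hi.2, Pi.single_eq_of_ne (Ne.symm hi.1)]
    rfl

theorem listPder_single {i : Fin n} {L : List (Fin n)} (hi : i ∈ L) (hL : L.Nodup)
    (f : (Fin n → ℝ) → E) : listPder (Pi.single i 1) L f = pder i f := by
  induction L with
  | nil => simp at hi
  | cons a L ih =>
    rw [List.nodup_cons] at hL
    rw [listPder_cons]
    by_cases h : i = a
    · subst h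
      rw [listPder_single_of_notMem hL.1, Pi.single_eq_same]
      rfl
    · rw [ih ((List.mem_cons.1 hi).resolve_left h) hL.2, Pi.single_eq_of_ne (Ne.symm h)]
      rfl

theorem ContDiff.mpder {f : (Fin n → ℝ) → E} (hf : ContDiff ℝ (⊤ : ℕ∞) f) (γ : Fin n → ℕ) :
    ContDiff ℝ (⊤ : ℕ∞) (mpder γ f) := by
  rw [mpder_eq_listPder]
  exact hf.listPder γ _

theorem mpder_add {f : (Fin n → ℝ) → E} (hf : ContDiff ℝ (⊤ : ℕ∞) f) (β γ : Fin n → ℕ) :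
    mpder (β + γ) f = mpder β (mpder γ f) := by
  simp only [mpder_eq_listPder, listPder_add hf]

theorem mpder_single (i : Fin n) (f : (Fin n → ℝ) → E) : mpder (Pi.single i 1) f = pder i f := by
  rw [mpder_eq_listPder, listPder_single (List.mem_finRange i) (List.nodup_finRange n)]

theorem mpder_zero (f : (Fin n → ℝ) → E) : mpder 0 f = f := by
  rw [mpder_eq_listPder]
  induction List.finRange n with
  | nil => rfl
  | cons a L ih => rw [listPder_cons, ih]; rfl

theorem pder_const_smul_comp_smul {f : (Fin n → ℝ) → E} (hf : ContDiff ℝ (⊤ : ℕ∞) f)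
    (c l : ℝ) (i : Fin n) :
    pder i (fun y => c • f (l • y)) = fun y => (c * l) • pder i f (l • y) := by
  funext y
  have h1 : HasFDerivAt (fun y : Fin n → ℝ => l • y)
      (l • ContinuousLinearMap.id ℝ (Fin n → ℝ)) y := (hasFDerivAt_id (𝕜 := ℝ) y).const_smul l
  have h2 := ((((hf.differentiable (by simp)) (l • y)).hasFDerivAt.comp y h1).const_smul c).fderiv
  change fderiv ℝ (c • (f ∘ fun y => l • y)) y (Pi.single i 1) = _
  rw [h2]
  simp [pder, mul_smul]

theorem pder_iterate_const_smul_comp_smul {f : (Fin n → ℝ) → E} (hf : ContDiff ℝ (⊤ : ℕ∞) f)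
    (c l : ℝ) (i : Fin n) (k : ℕ) :
    (pder i)^[k] (fun y => c • f (l • y)) = fun y => (c * l ^ k) • (pder i)^[k] f (l • y) := by
  induction k with
  | zero => simp
  | succ k ih =>
    rw [Function.iterate_succ_apply', ih, pder_const_smul_comp_smul (hf.pder_iterate i k),
      Function.iterate_succ_apply', pow_succ, mul_assoc]

theorem listPder_comp_smul {f : (Fin n → ℝ) → E} (hf : ContDiff ℝ (⊤ : ℕ∞) f) (l : ℝ)
    (γ : Fin n → ℕ) (L : List (Fin n)) :
    listPder γ L (fun y => f (l • y)) = fun y => l ^ (L.map γ).sum • listPder γ L f (l • y) := by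
  induction L with
  | nil => simp [listPder]
  | cons a L ih =>
    rw [listPder_cons, ih, pder_iterate_const_smul_comp_smul (hf.listPder γ L), listPder_cons,
      List.map_cons, List.sum_cons, ← pow_add, add_comm]

theorem mpder_comp_smul {f : (Fin n → ℝ) → E} (hf : ContDiff ℝ (⊤ : ℕ∞) f) (l : ℝ)
    (γ : Fin n → ℕ) (x : Fin n → ℝ) :
    mpder γ (fun y => f (l • y)) x = l ^ (∑ i, γ i) • mpder γ f (l • x) := by
  rw [mpder_eq_listPder, listPder_comp_smul hf, ← List.sum_ofFn, List.ofFn_eq_map]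

theorem hasDerivAt_comp_smul {f : (Fin n → ℝ) → E} (hf : Differentiable ℝ f) (x : Fin n → ℝ)
    (l : ℝ) : HasDerivAt (fun t : ℝ => f (t • x)) (∑ i, x i • pder i f (l • x)) l := by
  have h1 : HasDerivAt (fun t : ℝ => t • x) x l := by
    simpa using (hasDerivAt_id l).smul_const x
  have h2 := (hf (l • x)).hasFDerivAt.comp_hasDerivAt l h1
  have h3 : ∑ i, x i • Pi.single i (1 : ℝ) = x := by
    ext j
    simp [Pi.single_apply]
  refine h2.congr_deriv ?_
  simpa only [pder, map_sum, map_smul] using (congrArg (fderiv ℝ f (l • x)) h3).symm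

end Derivatives

theorem Finset.Nat.sum_antidiagonalTuple_succ_sum_mul {n d : ℕ} {R : Type*} [CommSemiring R]
    (c : (Fin n → ℕ) → R) :
    ∑ β ∈ antidiagonalTuple n (d + 1), ((d + 1 : ℕ) : R) * c β =
      ∑ i, ∑ α ∈ antidiagonalTuple n d, ((α i + 1 : ℕ) : R) * c (α + Pi.single i 1) := by
  have h1 : ∀ β ∈ antidiagonalTuple n (d + 1),
      ((d + 1 : ℕ) : R) * c β = ∑ i, (β i : R) * c β := by
    intro β hβ
    rw [mem_antidiagonalTuple] at hβ
    rw [← hβ, Nat.cast_sum, Finset.sum_mul]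
  rw [Finset.sum_congr rfl h1, Finset.sum_comm]
  refine Finset.sum_congr rfl fun i _ => ?_
  symm
  refine Finset.sum_of_injOn (fun α => α + Pi.single i 1) (add_left_injective _).injOn ?_ ?_ ?_
  · intro α hα
    simp only [Finset.mem_coe, mem_antidiagonalTuple] at hα ⊢
    simp [Finset.sum_add_distrib, hα]
  · intro β hβ hβ'
    have : β i = 0 := by
      by_contra h0
      have hsub : β - Pi.single i 1 + Pi.single i 1 = β := by
        funext j
        rcases eq_or_ne j i with rfl | hj
        · simp; omega
        · simp [hj]
      refine hβ' ⟨β - Pi.single i 1, ?_, hsub⟩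
      rw [mem_antidiagonalTuple] at hβ
      rw [← hsub] at hβ
      simp only [Finset.mem_coe, mem_antidiagonalTuple]
      simpa [Finset.sum_add_distrib] using hβ
    simp [this]
  · intro α _
    simp

/-- The homogeneous Taylor polynomial of degree `d` of `g` at `0`. -/
noncomputable def taylorTerm {n : ℕ} (d : ℕ) (g : (Fin n → ℝ) → ℝ) (x : Fin n → ℝ) : ℝ :=
  ∑ β ∈ Finset.Nat.antidiagonalTuple n d,
    mpder β g 0 * (∏ i, x i ^ β i) / ∏ i, ((β i).factorial : ℝ)

theorem taylorTerm_zero {n : ℕ} (g : (Fin n → ℝ) → ℝ) (x : Fin n → ℝ) :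
    taylorTerm 0 g x = g 0 := by
  simp [taylorTerm, Finset.Nat.antidiagonalTuple_zero_right, mpder_zero]

theorem taylorTerm_succ {n : ℕ} (d : ℕ) {g : (Fin n → ℝ) → ℝ} (hg : ContDiff ℝ (⊤ : ℕ∞) g)
    (x : Fin n → ℝ) :
    ((d + 1 : ℕ) : ℝ) * taylorTerm (d + 1) g x = ∑ i, x i * taylorTerm d (pder i g) x := by
  rw [taylorTerm, Finset.mul_sum, Finset.Nat.sum_antidiagonalTuple_succ_sum_mul]
  refine Finset.sum_congr rfl fun i _ => ?_
  rw [taylorTerm, Finset.mul_sum]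
  refine Finset.sum_congr rfl fun α _ => ?_
  have hpow : ∏ j, x j ^ (α + Pi.single i 1 : Fin n → ℕ) j = (∏ j, x j ^ α j) * x i := by
    simp only [Pi.add_apply, pow_add, Finset.prod_mul_distrib]
    congr 1
    rw [Finset.prod_eq_single i] <;> simp +contextual
  have hfac : ∏ j, (((α + Pi.single i 1 : Fin n → ℕ) j).factorial : ℝ) =
      (α i + 1 : ℕ) * ∏ j, ((α j).factorial : ℝ) := by
    rw [← Finset.mul_prod_erase _ _ (Finset.mem_univ i),
      ← Finset.mul_prod_erase (a := i) Finset.univ (fun j => ((α j).factorial : ℝ))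
        (Finset.mem_univ i), ← mul_assoc]
    congr 1
    · simp [Nat.factorial_succ]
    · refine Finset.prod_congr rfl fun j hj => ?_
      simp [Finset.ne_of_mem_erase hj]
  have hne : ∏ j, ((α j).factorial : ℝ) ≠ 0 :=
    Finset.prod_ne_zero_iff.2 fun j _ => by positivity
  have hne' : ((α i + 1 : ℕ) : ℝ) ≠ 0 := by positivity
  rw [mpder_add hg, mpder_single, hpow, hfac]
  field_simp

theorem tendsto_comp_smul_div_pow {n : ℕ} (d : ℕ) {g : (Fin n → ℝ) → ℝ}
    (hg : ContDiff ℝ (⊤ : ℕ∞) g)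
    (hz : ∀ β : Fin n → ℕ, (∑ i, β i) < d → mpder β g 0 = 0) (x : Fin n → ℝ) :
    Tendsto (fun l : ℝ => g (l • x) / l ^ d) (𝓝[>] 0) (𝓝 (taylorTerm d g x)) := by
  have hcont : ∀ {f : (Fin n → ℝ) → ℝ}, Continuous f →
      Tendsto (fun l : ℝ => f (l • x)) (𝓝[>] 0) (𝓝 (f 0)) := by
    intro f hf
    have : Continuous fun l : ℝ => f (l • x) := by fun_prop
    simpa using (this.tendsto 0).mono_left nhdsWithin_le_nhds
  induction d generalizing g with
  | zero => simpa [taylorTerm_zero] using hcont hg.continuous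
  | succ d ih =>
    have hlim : Tendsto (fun l : ℝ => (∑ i, x i • pder i g (l • x)) / (((d + 1 : ℕ) : ℝ) * l ^ d))
        (𝓝[>] 0) (𝓝 (taylorTerm (d + 1) g x)) := by
      have hne : ((d + 1 : ℕ) : ℝ) ≠ 0 := by positivity
      have h1 : Tendsto (fun l : ℝ => ∑ i, x i * (pder i g (l • x) / l ^ d)) (𝓝[>] 0)
          (𝓝 (∑ i, x i * taylorTerm d (pder i g) x)) := by
        refine tendsto_finsetSum _ fun i _ => (ih (hg.pder i) fun β hβ => ?_).const_mul _
        rw [← mpder_single, ← mpder_add hg]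
        refine hz _ ?_
        simpa [Finset.sum_add_distrib] using hβ
      rw [← taylorTerm_succ d hg] at h1
      have h2 := h1.div_const ((d + 1 : ℕ) : ℝ)
      rw [mul_div_cancel_left₀ _ hne] at h2
      refine h2.congr fun l => ?_
      simp only [Finset.sum_div, smul_eq_mul]
      refine Finset.sum_congr rfl fun i _ => ?_
      ring
    refine HasDerivAt.lhopital_zero_nhdsGT
      (.of_forall fun l => hasDerivAt_comp_smul (hg.differentiable (by simp)) x l)
      (.of_forall fun l => by simpa using hasDerivAt_pow (d + 1) l) ?_ ?_ ?_ (by simpa using hlim)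
    · filter_upwards [self_mem_nhdsWithin] with l (hl : 0 < l)
      positivity
    · have h0 : g 0 = 0 := by simpa [mpder_zero] using hz 0 (by simp)
      simpa [h0] using hcont hg.continuous
    · have : Continuous fun l : ℝ => l ^ (d + 1) := by fun_prop
      simpa using (this.tendsto 0).mono_left nhdsWithin_le_nhds

/-- If all partial derivatives of `h` of order `< q` vanish at `0` and `θ := max(|γ|, q)`, then
`λ^{−θ} ∂^γ(h ∘ f_λ)(x) = λ^{|γ|−θ} (∂^γ h)(λx)` converges, as `λ → 0⁺`, to the homogeneous
Taylor polynomial `Σ_{|β| = θ−|γ|} (∂^{β+γ}h)(0) x^β / β!` of degree `θ − |γ|` of `∂^γ h` at `0`;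
in particular, when `|γ| ≥ q` the limit is `(∂^γ h)(0)`. -/
theorem rescaled_deriv_tendsto_taylor {n : ℕ} (h : (Fin n → ℝ) → ℝ) (hsm : ContDiff ℝ (⊤ : ℕ∞) h)
    (q : ℕ) (hq : ∀ β : Fin n → ℕ, (∑ i, β i) < q → mpder β h 0 = 0)
    (γ : Fin n → ℕ) :
    (∀ l : ℝ, 0 < l → ∀ x : Fin n → ℝ,
      l ^ (-(max (∑ i, γ i) q : ℤ)) * mpder γ (fun y => h (l • y)) x
        = l ^ ((∑ i, γ i : ℤ) - (max (∑ i, γ i) q : ℤ)) * mpder γ h (l • x)) ∧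
    (∀ x : Fin n → ℝ,
      Tendsto
        (fun l : ℝ => l ^ (-(max (∑ i, γ i) q : ℤ)) * mpder γ (fun y => h (l • y)) x)
        (𝓝[>] (0 : ℝ))
        (𝓝 (∑ β ∈ Finset.Nat.antidiagonalTuple n (max (∑ i, γ i) q - ∑ i, γ i),
          mpder (β + γ) h 0 * (∏ i, x i ^ β i) / ∏ i, ((β i).factorial : ℝ)))) ∧
    (q ≤ ∑ i, γ i → ∀ x : Fin n → ℝ,
      Tendsto
        (fun l : ℝ => l ^ (-(max (∑ i, γ i) q : ℤ)) * mpder γ (fun y => h (l • y)) x)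
        (𝓝[>] (0 : ℝ)) (𝓝 (mpder γ h 0))) := by
  have hscale : ∀ l : ℝ, 0 < l → ∀ x : Fin n → ℝ,
      l ^ (-(max (∑ i, γ i) q : ℤ)) * mpder γ (fun y => h (l • y)) x
        = l ^ ((∑ i, γ i : ℤ) - (max (∑ i, γ i) q : ℤ)) * mpder γ h (l • x) := by
    intro l hl x
    rw [mpder_comp_smul hsm, smul_eq_mul, ← mul_assoc, ← zpow_natCast, ← zpow_add₀ hl.ne']
    congr 2
    push_cast
    ring
  have hlim : ∀ x : Fin n → ℝ, Tendsto
      (fun l : ℝ => l ^ (-(max (∑ i, γ i) q : ℤ)) * mpder γ (fun y => h (l • y)) x) (𝓝[>] 0)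
      (𝓝 (taylorTerm (max (∑ i, γ i) q - ∑ i, γ i) (mpder γ h) x)) := by
    intro x
    refine (tendsto_comp_smul_div_pow _ (hsm.mpder γ) (fun β hβ => ?_) x).congr' ?_
    · rw [← mpder_add hsm]
      refine hq _ ?_
      simp only [Pi.add_apply, Finset.sum_add_distrib]
      omega
    · filter_upwards [self_mem_nhdsWithin] with l hl
      rw [hscale l hl, div_eq_inv_mul, ← zpow_natCast, ← zpow_neg,
        Nat.cast_sub (le_max_left _ _)]
      congr 2
      push_cast
      ring
  refine ⟨hscale, fun x => ?_, fun hle x => ?_⟩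
  · simpa only [taylorTerm, mpder_add hsm] using hlim x
  · simpa [max_eq_left hle, taylorTerm_zero] using hlim x
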